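/- Let A be a formally real commutative von Neumann regular ring. Then A is real closed * if and only if A is Baer and for every prime ideal p of A the residue field A/p is a real closed field. -/

import Mathlib

universe u

/-- A commutative ring is formally real if a finite sum of squares can only vanish
when all the summands vanish. -/
def IsFormallyRealRing (R : Type*) [CommRing R] : Prop :=
  ∀ (n : ℕ) (f : Fin n → R), (∑ i, f i ^ 2) = 0 → ∀ i, f i = 0

/-- A subring `A` of `R` is essential in `R` if every nonzero ideal of `R` meets `A`
in a nonzero element. -/
def Subring.IsEssentialIn {R : Type*} [CommRing R] (A : Subring R) : Prop :=
  ∀ I : Ideal R, I ≠ ⊥ → ∃ x ∈ I, x ∈ A ∧ x ≠ 0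

/-- A commutative ring `A` is real closed * if it is formally real and it admits no
proper formally real extension ring that is both integral over `A` and an essential
extension of `A`: every embedding of `A` into a formally real ring `B` which is
integral over (the image of) `A` and essential over it is surjective. -/
def IsRealClosedStar (A : Type u) [CommRing A] : Prop :=
  IsFormallyRealRing A ∧
    ∀ (B : Type u) [CommRing B] (f : A →+* B), Function.Injective f →
      IsFormallyRealRing B →
      (∀ b : B, ∃ p : Polynomial B, p.Monic ∧ (∀ n, p.coeff n ∈ f.range) ∧
        Polynomial.eval b p = 0) →
      (f.range : Subring B).IsEssentialIn →
      Function.Surjective f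

/-- A commutative ring is a real closed field if it is a field, it is formally real
(`-1` is not a sum of squares), every element or its negative is a square, and every
polynomial of odd degree has a root. -/
def IsRealClosedField (F : Type*) [CommRing F] : Prop :=
  IsField F ∧
  (¬ ∃ (n : ℕ) (f : Fin n → F), (∑ i, f i ^ 2) = -1) ∧
  (∀ x : F, (∃ y : F, y ^ 2 = x) ∨ (∃ y : F, y ^ 2 = -x)) ∧
  (∀ p : Polynomial F, Odd p.natDegree → ∃ x : F, Polynomial.eval x p = 0)

/-- A commutative ring is Baer if the annihilator of every subset is generated by an
idempotent. -/
def IsBaer (R : Type*) [CommRing R] : Prop :=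
  ∀ S : Set R, ∃ e : R, e * e = e ∧
    ∀ r : R, (∀ s ∈ S, r * s = 0) ↔ ∃ x : R, r = e * x


open Polynomial

section FormallyReal

theorem IsSumSq.map {R S : Type*} [CommRing R] [CommRing S] (f : R →+* S) {s : R}
    (hs : IsSumSq s) : IsSumSq (f s) := by
  induction hs with
  | zero => simp
  | sq_add a _ ih => simpa using IsSumSq.sq_add (f a) ih

theorem IsSumSq.exists_of_surjective {R S : Type*} [CommRing R] [CommRing S] {f : R →+* S}
    (hf : Function.Surjective f) {s : S} (hs : IsSumSq s) : ∃ r, IsSumSq r ∧ f r = s := by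
  induction hs with
  | zero => exact ⟨0, .zero, map_zero f⟩
  | sq_add a _ ih =>
    obtain ⟨r, hr, rfl⟩ := ih
    obtain ⟨a, rfl⟩ := hf a
    exact ⟨a * a + r, .sq_add a hr, by simp⟩

theorem isSumSq_iff_exists_fin {R : Type*} [CommRing R] {s : R} :
    IsSumSq s ↔ ∃ (n : ℕ) (f : Fin n → R), ∑ i, f i ^ 2 = s := by
  constructor
  · intro hs
    induction hs with
    | zero => exact ⟨0, Fin.elim0, by simp⟩
    | sq_add a _ ih =>
      obtain ⟨n, f, rfl⟩ := ih
      exact ⟨n + 1, Fin.cons a f, by simp [Fin.sum_univ_succ, sq]⟩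
  · rintro ⟨n, f, rfl⟩
    exact IsSumSq.sum_sq _ _

theorem isFormallyRealRing_iff {R : Type*} [CommRing R] :
    IsFormallyRealRing R ↔ ∀ a s : R, IsSumSq s → a * a + s = 0 → a = 0 := by
  constructor
  · intro h a s hs has
    obtain ⟨n, f, rfl⟩ := isSumSq_iff_exists_fin.1 hs
    exact h (n + 1) (Fin.cons a f) (by simpa [Fin.sum_univ_succ, sq] using has) 0
  · intro h n f hf i
    refine h (f i) (∑ j ∈ Finset.univ.erase i, f j ^ 2) (IsSumSq.sum_sq _ _) ?_
    rw [← sq, Finset.add_sum_erase _ (fun j => f j ^ 2) (Finset.mem_univ i), hf]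

theorem isFormallyRealRing_iff_not_isSumSq_neg_one {F : Type*} [Field F] :
    IsFormallyRealRing F ↔ ¬ IsSumSq (-1 : F) := by
  rw [isFormallyRealRing_iff]
  constructor
  · intro h hs
    exact one_ne_zero (h 1 _ hs (by ring))
  · intro h a s hs has
    by_contra ha
    refine h ?_
    have : (-1 : F) = (a⁻¹ * a⁻¹) * s := by
      rw [eq_neg_of_add_eq_zero_right has]
      field_simp
    rw [this]
    exact (IsSumSq.mul_self _).mul hs

namespace IsFormallyRealRing

variable {R S : Type*} [CommRing R] [CommRing S]

theorem isReduced (h : IsFormallyRealRing R) : IsReduced R := by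
  rw [isReduced_iff_pow_one_lt 2 one_lt_two]
  intro x hx
  exact isFormallyRealRing_iff.1 h x 0 .zero (by rw [← sq, hx, add_zero])

theorem of_injective (h : IsFormallyRealRing S) (f : R →+* S) (hf : Function.Injective f) :
    IsFormallyRealRing R := by
  rw [isFormallyRealRing_iff] at h ⊢
  intro a s hs has
  refine hf ?_
  rw [map_zero]
  exact h (f a) (f s) (hs.map f) (by rw [← map_mul, ← map_add, has, map_zero])

theorem pi {ι : Type*} {K : ι → Type*} [∀ i, CommRing (K i)]
    (h : ∀ i, IsFormallyRealRing (K i)) : IsFormallyRealRing (∀ i, K i) := by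
  rw [isFormallyRealRing_iff]
  intro a s hs has
  ext i
  exact isFormallyRealRing_iff.1 (h i) (a i) (s i) (hs.map (Pi.evalRingHom K i))
    (congrFun has i)

theorem prod (hR : IsFormallyRealRing R) (hS : IsFormallyRealRing S) :
    IsFormallyRealRing (R × S) := by
  rw [isFormallyRealRing_iff] at hR hS ⊢
  intro a s hs has
  exact Prod.ext (hR _ _ (hs.map (RingHom.fst R S)) (congrArg Prod.fst has))
    (hS _ _ (hs.map (RingHom.snd R S)) (congrArg Prod.snd has))

theorem quotient {I : Ideal R} (h : ∀ a s : R, IsSumSq s → a * a + s ∈ I → a ∈ I) :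
    IsFormallyRealRing (R ⧸ I) := by
  rw [isFormallyRealRing_iff]
  intro a s hs has
  obtain ⟨s, hs', rfl⟩ := hs.exists_of_surjective Ideal.Quotient.mk_surjective
  obtain ⟨a, rfl⟩ := Ideal.Quotient.mk_surjective a
  rw [Ideal.Quotient.eq_zero_iff_mem]
  refine h a s hs' ?_
  rwa [← Ideal.Quotient.eq_zero_iff_mem, map_add, map_mul]

theorem quotient_of_regular (hreg : ∀ a : R, ∃ b : R, a = a * b * a)
    (h : IsFormallyRealRing R) (I : Ideal R) : IsFormallyRealRing (R ⧸ I) := by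
  refine quotient fun a s hs has => ?_
  obtain ⟨u, hu⟩ := hreg (a * a + s)
  set x := a * a + s with hx
  have key : (1 - x * u) * a = 0 := by
    refine isFormallyRealRing_iff.1 h _ ((1 - x * u) * (1 - x * u) * s)
      ((IsSumSq.mul_self _).mul hs) ?_
    have : (1 - x * u) * x = 0 := by linear_combination hu
    linear_combination (1 - x * u) * this - (1 - x * u) * (1 - x * u) * hx
  have : a = x * (u * a) := by linear_combination key
  rw [this]
  exact I.mul_mem_right _ has

theorem quotient_annihilator (h : IsFormallyRealRing R) {I : Ideal R} (T : Set R)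
    (hI : ∀ r, r ∈ I ↔ ∀ t ∈ T, r * t = 0) : IsFormallyRealRing (R ⧸ I) := by
  refine quotient fun a s hs has => (hI a).2 fun t ht => ?_
  refine isFormallyRealRing_iff.1 h _ (t * t * s) ((IsSumSq.mul_self _).mul hs) ?_
  linear_combination t * (hI _).1 has t ht

end IsFormallyRealRing

end FormallyReal

section Regular

variable {A B : Type*} [CommRing A] [CommRing B]

theorem Ideal.exists_notMem_mul_eq_zero_of_regular (hreg : ∀ a : A, ∃ b : A, a = a * b * a)
    {p : Ideal A} (hp : p.IsPrime) {x : A} (hx : x ∈ p) :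
    ∃ e, e * e = e ∧ e ∉ p ∧ e * x = 0 := by
  obtain ⟨u, hu⟩ := hreg x
  refine ⟨1 - x * u, by linear_combination -u * hu, fun h => hp.one_notMem ?_,
    by linear_combination hu⟩
  simpa using p.add_mem h (p.mul_mem_right u hx)

theorem Ideal.IsPrime.isMaximal_of_regular (hreg : ∀ a : A, ∃ b : A, a = a * b * a)
    {p : Ideal A} (hp : p.IsPrime) : p.IsMaximal := by
  refine Ideal.isMaximal_iff.2 ⟨hp.one_notMem, fun J x hpJ hxp hxJ => ?_⟩
  obtain ⟨u, hu⟩ := hreg x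
  have : 1 - x * u ∈ p := (hp.mem_or_mem (show (1 - x * u) * x ∈ p by
    rw [show (1 - x * u) * x = 0 by linear_combination hu]; exact p.zero_mem)).resolve_right hxp
  simpa using J.add_mem (hpJ this) (J.mul_mem_right u hxJ)

/-- A reduced integral extension of a von Neumann regular ring is von Neumann regular. -/
theorem regular_of_isIntegral [Algebra A B] [IsReduced B] (hreg : ∀ a : A, ∃ b : A, a = a * b * a)
    (hintg : Algebra.IsIntegral A B) (b : B) : ∃ c : B, b = b * c * b := by
  have key : ∀ (n : ℕ) (g : A[X]) (e : B) (k : ℕ), g.Monic → g.natDegree = n →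
      e * b ^ k * aeval b g = 0 → ∃ c, e * b = b * c * b := by
    intro n
    induction n with
    | zero =>
      intro g e k hg hn h
      rw [hg.natDegree_eq_zero.1 hn, map_one, mul_one] at h
      refine ⟨0, ?_⟩
      rw [mul_zero, zero_mul]
      refine IsReduced.eq_zero _ ⟨k + 1, ?_⟩
      linear_combination e ^ k * b * h
    | succ n ih =>
      intro g e k hg hn h
      obtain ⟨u, hu⟩ := hreg (g.coeff 0)
      have hg' := divX_mul_X_add g
      have hdeg : g.divX.natDegree = n := by rw [natDegree_divX_eq_natDegree_tsub_one, hn]; rfl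
      have hmon : g.divX.Monic := by
        rw [Monic, leadingCoeff, hdeg, coeff_divX, ← hn]; exact hg
      have hb : aeval b g = aeval b g.divX * b + algebraMap A B (g.coeff 0) := by
        conv_lhs => rw [← hg']
        simp
      rw [hb] at h
      have hu' := congrArg (algebraMap A B) hu
      simp only [map_mul] at hu'
      set c := algebraMap A B (g.coeff 0)
      set v := algebraMap A B u
      set d := aeval b g.divX with hd
      obtain ⟨y, hy⟩ := ih g.divX (e * (1 - c * v)) (k + 1) hmon hdeg (by
        rw [← hd]; linear_combination (1 - c * v) * h - e * b ^ k * hu')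
      have hz : e * (c * v) * b * (d * b * v + 1) = 0 := by
        refine IsReduced.eq_zero _ ⟨k + 1, ?_⟩
        have : e * (c * v) * b ^ k * (d * b * v + 1) = 0 := by
          linear_combination c * v * v * h + e * b ^ k * v * hu'
        rw [mul_pow, mul_pow]
        linear_combination (e * (c * v)) ^ k * b * (d * b * v + 1) ^ k * this
      exact ⟨y - e * (c * v) * d * v, by linear_combination hy + hz⟩
  obtain ⟨g, hg, hgb⟩ := hintg.isIntegral b
  obtain ⟨c, hc⟩ := key _ g 1 0 hg rfl (by rw [← aeval_def] at hgb; simp [hgb])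
  exact ⟨c, by simpa using hc⟩

end Regular

section FieldExtensions

/-- Over a formally real field `F`, either `a` is a square in some formally real extension field,
or `-a` is a sum of squares (up to a nonzero square factor). -/
theorem IsFormallyRealRing.exists_sqrt_or_isSumSq {F : Type u} [Field F]
    (hF : IsFormallyRealRing F) (a : F) :
    (∃ (K : Type u) (_ : Field K) (f : F →+* K), IsFormallyRealRing K ∧ ∃ y, y ^ 2 = f a) ∨
      ∃ t : F, t ≠ 0 ∧ IsSumSq (t * t * -a) := by
  by_cases hsq : ∃ b : F, b ^ 2 = a
  · obtain ⟨b, hb⟩ := hsq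
    exact .inl ⟨F, inferInstance, RingHom.id F, hF, b, by simpa using hb⟩
  push Not at hsq
  have hirr : Irreducible (X ^ 2 - C a) := X_pow_sub_C_irreducible_of_prime Nat.prime_two hsq
  have : Fact (Irreducible (X ^ 2 - C a)) := ⟨hirr⟩
  set of := AdjoinRoot.of (X ^ 2 - C a) with hof
  set r := AdjoinRoot.root (X ^ 2 - C a) with hr
  have hroot : r ^ 2 = of a := by
    have := AdjoinRoot.eval₂_root (X ^ 2 - C a)
    simpa [sub_eq_zero] using this
  have hform : ∀ z : AdjoinRoot (X ^ 2 - C a), ∃ x y : F, z = of x + of y * r := by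
    intro z
    obtain ⟨p, rfl⟩ := AdjoinRoot.mk_surjective z
    induction p using Polynomial.induction_on' with
    | add p q hp hq =>
      obtain ⟨x, y, hp⟩ := hp
      obtain ⟨x', y', hq⟩ := hq
      exact ⟨x + x', y + y', by rw [map_add, hp, hq, map_add, map_add]; ring⟩
    | monomial n c =>
      induction n with
      | zero => exact ⟨c, 0, by simp [hof]⟩
      | succ n ih =>
        obtain ⟨x, y, h⟩ := ih
        refine ⟨y * a, x, ?_⟩
        rw [← monomial_mul_X, map_mul, h, AdjoinRoot.mk_X, ← hr, map_mul, ← hroot]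
        ring
  by_cases hK : IsFormallyRealRing (AdjoinRoot (X ^ 2 - C a))
  · exact .inl ⟨_, inferInstance, of, hK, r, hroot⟩
  right
  rw [isFormallyRealRing_iff_not_isSumSq_neg_one, not_not] at hK
  have hsum : ∀ z, IsSumSq z → ∃ P Q R : F, IsSumSq P ∧ IsSumSq Q ∧
      z = of (P + a * Q) + of R * r := by
    intro z hz
    induction hz with
    | zero => exact ⟨0, 0, 0, .zero, .zero, by simp⟩
    | sq_add w _ ih =>
      obtain ⟨P, Q, R, hP, hQ, rfl⟩ := ih
      obtain ⟨x, y, rfl⟩ := hform w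
      refine ⟨x * x + P, y * y + Q, 2 * x * y + R, .sq_add _ hP, .sq_add _ hQ, ?_⟩
      simp only [map_add, map_mul, map_ofNat, ← hroot]
      ring
  obtain ⟨P, Q, R, hP, hQ, h⟩ := hsum _ hK
  have hR : R = 0 := by
    by_contra hR
    refine hsq ((1 + P + a * Q) / R) (of.injective ?_)
    have hR' : of R ≠ 0 := (map_ne_zero of).2 hR
    rw [← hroot, map_pow, map_div₀, div_pow, div_eq_iff (pow_ne_zero 2 hR'), map_add, map_add,
      map_one]
    rw [map_add] at h
    linear_combination (of P + of (a * Q) + 1 - of R * r) * (-h)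
  have hPQ : -1 = P + a * Q := by
    rw [hR, map_zero, zero_mul, add_zero] at h
    exact of.injective (by rw [← h, map_neg, map_one])
  have hQ0 : Q ≠ 0 := by
    rintro rfl
    refine isFormallyRealRing_iff_not_isSumSq_neg_one.1 hF ?_
    rwa [hPQ, mul_zero, add_zero]
  refine ⟨Q, hQ0, ?_⟩
  rw [show Q * Q * -a = Q * (1 * 1 + P) by linear_combination Q * hPQ]
  exact hQ.mul (.sq_add 1 hP)

theorem IsFormallyRealRing.even_natDegree_of_isSumSq {F : Type*} [Field F]
    (hF : IsFormallyRealRing F) {s : F[X]} (hs : IsSumSq s) :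
    Even s.natDegree ∧ IsSumSq s.leadingCoeff := by
  induction hs with
  | zero => simp
  | @sq_add a s _ ih =>
    obtain rfl | ha := eq_or_ne a 0
    · simpa using ih
    have hdeg : (a * a).natDegree = a.natDegree + a.natDegree := natDegree_mul ha ha
    have hlead : (a * a).leadingCoeff = a.leadingCoeff * a.leadingCoeff := leadingCoeff_mul a a
    obtain rfl | hs0 := eq_or_ne s 0
    · rw [add_zero, hdeg, hlead]
      exact ⟨⟨_, rfl⟩, .mul_self _⟩
    rcases lt_trichotomy (a * a).natDegree s.natDegree with h | h | h
    · rw [natDegree_add_eq_right_of_natDegree_lt h,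
        leadingCoeff_add_of_degree_lt (degree_lt_degree h)]
      exact ih
    · have hne : (a * a).leadingCoeff + s.leadingCoeff ≠ 0 := by
        rw [hlead]
        exact fun h0 => leadingCoeff_ne_zero.2 ha (isFormallyRealRing_iff.1 hF _ _ ih.2 h0)
      have hdeg' : (a * a).degree = s.degree := by
        rw [degree_eq_natDegree hs0, degree_eq_natDegree (mul_ne_zero ha ha), h]
      have hd : (a * a + s).natDegree = s.natDegree := by
        rw [natDegree, degree_add_eq_of_leadingCoeff_add_ne_zero hne, hdeg', max_self, natDegree]
      rw [leadingCoeff_add_of_degree_eq hdeg' hne, hd, hlead]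
      exact ⟨ih.1, .sq_add _ ih.2⟩
    · rw [natDegree_add_eq_left_of_natDegree_lt h,
        leadingCoeff_add_of_degree_lt' (degree_lt_degree h), hdeg, hlead]
      exact ⟨⟨_, rfl⟩, .mul_self _⟩

/-- Every polynomial of odd degree over a formally real field has a root in some formally real
extension field. -/
theorem IsFormallyRealRing.exists_root_of_odd_natDegree {F : Type u} [Field F]
    (hF : IsFormallyRealRing F) (g : F[X]) (hg : Odd g.natDegree) :
    ∃ (K : Type u) (_ : Field K) (f : F →+* K), IsFormallyRealRing K ∧ ∃ y, eval₂ f y g = 0 := by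
  induction hn : g.natDegree using Nat.strong_induction_on generalizing g with
  | h n ih =>
  subst hn
  have hg0 : g ≠ 0 := by rintro rfl; simp at hg
  by_cases hirr : Irreducible g
  · have : Fact (Irreducible g) := ⟨hirr⟩
    by_cases hK : IsFormallyRealRing (AdjoinRoot g)
    · exact ⟨_, inferInstance, AdjoinRoot.of g, hK, AdjoinRoot.root g, AdjoinRoot.eval₂_root g⟩
    exfalso
    rw [isFormallyRealRing_iff_not_isSumSq_neg_one, not_not] at hK
    have hsum : ∀ z : AdjoinRoot g, IsSumSq z → ∃ s : F[X], IsSumSq s ∧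
        s.natDegree ≤ 2 * (g.natDegree - 1) ∧ AdjoinRoot.mk g s = z := by
      intro z hz
      induction hz with
      | zero => exact ⟨0, .zero, by simp, by simp⟩
      | sq_add w _ ih =>
        obtain ⟨s, hs, hsd, rfl⟩ := ih
        obtain ⟨p, rfl⟩ := AdjoinRoot.mk_surjective w
        have hmod : AdjoinRoot.mk g (p % g) = AdjoinRoot.mk g p := by
          rw [AdjoinRoot.mk_eq_mk]
          exact (EuclideanDomain.mod_eq_sub_mul_div p g).symm ▸ ⟨-(p / g), by ring⟩
        have hlt : (p % g).natDegree < g.natDegree := natDegree_mod_lt p hg.pos.ne'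
        refine ⟨p % g * (p % g) + s, .sq_add _ hs, ?_, by rw [map_add, map_mul, hmod]⟩
        refine (natDegree_add_le _ _).trans (max_le (natDegree_mul_le.trans ?_) hsd)
        lia
    obtain ⟨s, hs, hsd, hs1⟩ := hsum _ hK
    have hs' : IsSumSq (1 * 1 + s) := .sq_add 1 hs
    have hneg : ∀ (K : Type u) [Field K] (f : F →+* K) (y : K), IsFormallyRealRing K →
        eval₂ f y (1 * 1 + s) ≠ 0 := by
      intro K _ f y hK h
      refine one_ne_zero (isFormallyRealRing_iff.1 hK 1 _ (hs.map (eval₂RingHom f y)) ?_)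
      simpa using h
    have hne : 1 * 1 + s ≠ 0 := fun h => hneg F (RingHom.id F) 0 hF (by rw [h]; simp)
    obtain ⟨h, hh⟩ : g ∣ 1 * 1 + s := by
      rw [← AdjoinRoot.mk_eq_zero, map_add, hs1]; simp
    have hh0 : h ≠ 0 := by rintro rfl; exact hne (by rw [hh, mul_zero])
    have hdeg := natDegree_mul hg0 hh0
    have hev := (hF.even_natDegree_of_isSumSq hs').1
    have hle : (1 * 1 + s).natDegree ≤ 2 * (g.natDegree - 1) :=
      (natDegree_add_le _ _).trans (max_le (by simp) hsd)
    rw [hh, hdeg] at hev hle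
    obtain ⟨K, _, f, hK, y, hy⟩ := ih h.natDegree (by have := hg.pos; lia) h (by
      rw [Nat.even_add] at hev
      rw [← Nat.not_even_iff_odd] at hg ⊢
      tauto) rfl
    exact hneg K f y hK (by rw [hh, eval₂_mul, hy, mul_zero])
  · have hu : ¬ IsUnit g := fun h => by
      rw [natDegree_eq_zero_of_isUnit h] at hg; simp at hg
    obtain ⟨p, q, hp, hq, rfl⟩ : ∃ p q, ¬ IsUnit p ∧ ¬ IsUnit q ∧ g = p * q := by
      simp only [irreducible_iff, hu, not_false_eq_true, true_and] at hirr
      push Not at hirr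
      obtain ⟨p, q, h, hp, hq⟩ := hirr
      exact ⟨p, q, hp, hq, h⟩
    have hp0 : p ≠ 0 := left_ne_zero_of_mul hg0
    have hq0 : q ≠ 0 := right_ne_zero_of_mul hg0
    have hpd := natDegree_pos_iff_degree_pos.2 (degree_pos_of_ne_zero_of_nonunit hp0 hp)
    have hqd := natDegree_pos_iff_degree_pos.2 (degree_pos_of_ne_zero_of_nonunit hq0 hq)
    rw [natDegree_mul hp0 hq0] at hg ih
    rcases Nat.even_or_odd p.natDegree with h | h
    · obtain ⟨K, _, f, hK, y, hy⟩ := ih q.natDegree (by lia) q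
        (by rw [Nat.odd_add] at hg; rw [← Nat.not_even_iff_odd] at hg ⊢; tauto) rfl
      exact ⟨K, _, f, hK, y, by rw [eval₂_mul, hy, mul_zero]⟩
    · obtain ⟨K, _, f, hK, y, hy⟩ := ih p.natDegree (by lia) p h rfl
      exact ⟨K, _, f, hK, y, by rw [eval₂_mul, hy, zero_mul]⟩

end FieldExtensions

section RealClosed

variable {F N : Type*} [Field F] [Field N] [Algebra F N]

theorem IsRealClosedField.isFormallyRealRing (hF : IsRealClosedField F) :
    IsFormallyRealRing F := by
  rw [isFormallyRealRing_iff_not_isSumSq_neg_one, isSumSq_iff_exists_fin]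
  exact hF.2.1

theorem IsRealClosedField.charZero (hF : IsRealClosedField F) : CharZero F := by
  have := IsSemireal.of_not_isSumSq_neg_one
    (isFormallyRealRing_iff_not_isSumSq_neg_one.1 hF.isFormallyRealRing)
  infer_instance

theorem IsRealClosedField.eq_zero_of_sq_add_sq_add_sq (hF : IsRealClosedField F) {x y z : F}
    (h : x ^ 2 + y ^ 2 + z ^ 2 = 0) : x = 0 :=
  isFormallyRealRing_iff.1 hF.isFormallyRealRing x (y * y + z * z)
    (.sq_add _ (.mul_self _)) (by linear_combination h)

theorem IsRealClosedField.exists_eq_of_mem_adjoin (hF : IsRealClosedField F) {i : N}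
    (hi : i ^ 2 = -1) {z : N} (hz : z ∈ IntermediateField.adjoin F {i}) :
    ∃ x y : F, z = algebraMap F N x + algebraMap F N y * i := by
  induction hz using IntermediateField.adjoin_induction with
  | mem z hz => exact ⟨0, 1, by simp [Set.mem_singleton_iff.1 hz]⟩
  | algebraMap x => exact ⟨x, 0, by simp⟩
  | add z w _ _ hz hw =>
    obtain ⟨x, y, rfl⟩ := hz
    obtain ⟨x', y', rfl⟩ := hw
    exact ⟨x + x', y + y', by simp only [map_add]; ring⟩
  | mul z w _ _ hz hw =>
    obtain ⟨x, y, rfl⟩ := hz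
    obtain ⟨x', y', rfl⟩ := hw
    refine ⟨x * x' - y * y', x * y' + y * x', ?_⟩
    simp only [map_add, map_mul, map_sub]
    linear_combination algebraMap F N y * algebraMap F N y' * hi
  | inv z _ hz =>
    obtain ⟨x, y, rfl⟩ := hz
    by_cases h : x ^ 2 + y ^ 2 = 0
    · have hx : x = 0 := hF.eq_zero_of_sq_add_sq_add_sq (y := y) (z := 0) (by linear_combination h)
      have hy : y = 0 := hF.eq_zero_of_sq_add_sq_add_sq (y := x) (z := 0)
        (by linear_combination h)
      exact ⟨0, 0, by simp [hx, hy]⟩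
    · refine ⟨x / (x ^ 2 + y ^ 2), -y / (x ^ 2 + y ^ 2), inv_eq_of_mul_eq_one_right ?_⟩
      have h' : algebraMap F N (x ^ 2 + y ^ 2) ≠ 0 := (_root_.map_ne_zero _).2 h
      rw [map_div₀, map_div₀]
      field_simp
      simp only [map_add, map_pow, map_neg]
      linear_combination -(algebraMap F N y) ^ 2 * hi

theorem IsRealClosedField.exists_sq_eq (hF : IsRealClosedField F) {i : N} (hi : i ^ 2 = -1)
    (x y : F) : ∃ u v : F,
      (algebraMap F N u + algebraMap F N v * i) ^ 2 = algebraMap F N x + algebraMap F N y * i := by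
  have := hF.charZero
  have hsq := hF.2.2.1
  suffices h : ∃ u v : F, u ^ 2 - v ^ 2 = x ∧ 2 * u * v = y by
    obtain ⟨u, v, rfl, rfl⟩ := h
    refine ⟨u, v, ?_⟩
    simp only [map_sub, map_mul, map_pow, map_ofNat]
    linear_combination algebraMap F N v ^ 2 * hi
  by_cases hy : y = 0
  · obtain ⟨w, hw⟩ | ⟨w, hw⟩ := hsq x
    · exact ⟨w, 0, by simp [hw], by simp [hy]⟩
    · exact ⟨0, w, by simp [hw], by simp [hy]⟩
  obtain ⟨r, hr⟩ : ∃ r, r ^ 2 = x ^ 2 + y ^ 2 := by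
    obtain h | ⟨w, hw⟩ := hsq (x ^ 2 + y ^ 2)
    · exact h
    · exact absurd (hF.eq_zero_of_sq_add_sq_add_sq (x := y) (y := x) (z := w)
        (by linear_combination hw)) hy
  obtain ⟨s, hs⟩ : ∃ s, (s ^ 2) ^ 2 = x ^ 2 + y ^ 2 := by
    obtain ⟨s, hs⟩ | ⟨s, hs⟩ := hsq r
    · exact ⟨s, by rw [hs, hr]⟩
    · exact ⟨s, by rw [hs, neg_sq, hr]⟩
  obtain ⟨u, hu⟩ | ⟨w, hw⟩ := hsq ((s ^ 2 + x) / 2)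
  · have hu' : 2 * u ^ 2 = s ^ 2 + x := by rw [hu]; field_simp
    have hu0 : u ≠ 0 := by
      rintro rfl
      refine hy (pow_eq_zero_iff two_ne_zero |>.1 (?_ : y ^ 2 = 0))
      linear_combination -hs - (s ^ 2 - x) * hu'
    refine ⟨u, y / (2 * u), ?_, by field_simp⟩
    field_simp
    linear_combination (2 * u ^ 2 + s ^ 2 - x) * hu' + hs
  · have hw' : 2 * w ^ 2 = -(s ^ 2 + x) := by rw [hw]; field_simp
    refine absurd (hF.eq_zero_of_sq_add_sq_add_sq (x := y) (y := 2 * s * w) (z := 2 * w ^ 2) ?_) hy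
    linear_combination (2 * w ^ 2 + s ^ 2 - x) * hw' - hs

theorem IsRealClosedField.finrank_eq_one_of_odd (hF : IsRealClosedField F) [FiniteDimensional F N]
    (hodd : Odd (Module.finrank F N)) : Module.finrank F N = 1 := by
  have := hF.charZero
  obtain ⟨α, hα⟩ := Field.exists_primitive_element F N
  have hintg : IsIntegral F α := .of_finite F α
  have hdeg : (minpoly F α).natDegree = Module.finrank F N := by
    rw [← IntermediateField.adjoin.finrank hintg, hα, IntermediateField.finrank_top']
  obtain ⟨x, hx⟩ := hF.2.2.2 (minpoly F α) (hdeg ▸ hodd)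
  rw [← hdeg]
  exact natDegree_eq_of_degree_eq_some
    (degree_eq_one_of_irreducible_of_root (minpoly.irreducible hintg) hx)

theorem IsRealClosedField.isPGroup_two (hF : IsRealClosedField F) [FiniteDimensional F N]
    [IsGalois F N] : IsPGroup 2 Gal(N/F) := by
  obtain ⟨P⟩ : Nonempty (Sylow 2 Gal(N/F)) := inferInstance
  have hidx : Module.finrank F (IntermediateField.fixedField (P : Subgroup Gal(N/F))) =
      (P : Subgroup Gal(N/F)).index := by
    rw [IntermediateField.finrank_eq_fixingSubgroup_index,
      IntermediateField.fixingSubgroup_fixedField]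
  have hone := hF.finrank_eq_one_of_odd (N := IntermediateField.fixedField (P : Subgroup Gal(N/F)))
    (by rw [hidx, ← Nat.not_even_iff_odd, even_iff_two_dvd]; exact P.not_dvd_index)
  rw [hidx, Subgroup.index_eq_one] at hone
  have := P.isPGroup'
  rw [hone] at this
  exact this.of_equiv Subgroup.topEquiv

/-- A field in which every element is a square has no quadratic extensions. -/
theorem finrank_ne_two_of_forall_isSquare {C E : Type*} [Field C] [Field E] [Algebra C E]
    [CharZero C] (hC : ∀ z : C, IsSquare z) : Module.finrank C E ≠ 2 := by
  intro h2
  have : FiniteDimensional C E := FiniteDimensional.of_finrank_pos (by lia)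
  obtain ⟨α, hα⟩ := Field.exists_primitive_element C E
  have hintg : IsIntegral C α := .of_finite C α
  have hdeg : (minpoly C α).natDegree = 2 := by
    rw [← IntermediateField.adjoin.finrank hintg, hα, IntermediateField.finrank_top', h2]
  have hlc := minpoly.monic hintg
  obtain ⟨x, hx⟩ : ∃ x, (minpoly C α).IsRoot x := by
    obtain ⟨s, hs⟩ := hC (discrim 1 ((minpoly C α).coeff 1) ((minpoly C α).coeff 0))
    obtain ⟨x, hx⟩ := exists_quadratic_eq_zero one_ne_zero ⟨s, hs⟩
    refine ⟨x, ?_⟩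
    have h1 : (minpoly C α).coeff 2 = 1 := by rw [← hdeg]; exact hlc
    rw [IsRoot, eval_eq_sum_range, hdeg]
    simp [Finset.sum_range_succ, h1]
    linear_combination hx
  have hdeg' : (minpoly C α).natDegree = 1 := natDegree_eq_of_degree_eq_some
    (degree_eq_one_of_irreducible_of_root (minpoly.irreducible hintg) hx)
  lia

theorem IsRealClosedField.adjoin_eq_top (hF : IsRealClosedField F) [FiniteDimensional F N]
    [IsGalois F N] {i : N} (hi : i ^ 2 = -1) : IntermediateField.adjoin F {i} = ⊤ := by
  have := hF.charZero
  set C := IntermediateField.adjoin F {i}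
  have hC : ∀ z : C, IsSquare z := by
    intro z
    obtain ⟨x, y, hxy⟩ := hF.exists_eq_of_mem_adjoin hi z.2
    obtain ⟨u, v, huv⟩ := hF.exists_sq_eq hi x y
    refine ⟨algebraMap F C u + algebraMap F C v * ⟨i, IntermediateField.mem_adjoin_simple_self F i⟩,
      Subtype.ext ?_⟩
    rw [hxy, ← huv, sq]
    rfl
  have : CharZero C := charZero_of_injective_algebraMap (algebraMap F C).injective
  have hp : IsPGroup 2 Gal(N/C) :=
    (hF.isPGroup_two.to_subgroup C.fixingSubgroup).of_equiv (IntermediateField.fixingSubgroupEquiv C)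
  obtain ⟨n, hn⟩ := hp.exists_card_eq
  rw [IsGalois.card_aut_eq_finrank] at hn
  rcases n with - | n
  · rw [pow_zero] at hn
    exact IntermediateField.finrank_eq_one_iff_eq_top.1 hn
  obtain ⟨J, hJ⟩ := Sylow.exists_subgroup_card_pow_prime (G := Gal(N/C)) 2 (n := n) (by
    rw [IsGalois.card_aut_eq_finrank, hn]; exact ⟨2, pow_succ _ _⟩)
  refine absurd ?_ (finrank_ne_two_of_forall_isSquare (E := IntermediateField.fixedField J) hC)
  have h1 := IntermediateField.finrank_fixedField_eq_card J
  have h2 := Module.finrank_mul_finrank C (IntermediateField.fixedField J) N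
  rw [h1, hJ, hn, pow_succ, mul_comm] at h2
  exact Nat.eq_of_mul_eq_mul_left (by positivity) h2

/-- A real closed field has no proper formally real algebraic extension field. -/
theorem IsRealClosedField.surjective_algebraMap {K : Type*} [Field K] [Algebra F K]
    [Algebra.IsAlgebraic F K] (hF : IsRealClosedField F) (hK : IsFormallyRealRing K) :
    Function.Surjective (algebraMap F K) := by
  intro b
  have := hF.charZero
  obtain ⟨i, hi⟩ : ∃ i : AlgebraicClosure K, i ^ 2 = -1 :=
    IsAlgClosed.exists_pow_nat_eq (-1) two_pos
  let c := algebraMap K (AlgebraicClosure K) b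
  let M := IntermediateField.adjoin F {c, i}
  have hfin : FiniteDimensional F M :=
    IntermediateField.finiteDimensional_adjoin fun x _ =>
      (Algebra.IsAlgebraic.isAlgebraic x).isIntegral
  let N := IntermediateField.normalClosure F M (AlgebraicClosure K)
  have hMN : M ≤ N := M.le_normalClosure
  have hcN : c ∈ N := hMN (IntermediateField.subset_adjoin F _ (by simp))
  have hiN : i ∈ N := hMN (IntermediateField.subset_adjoin F _ (by simp))
  have : IsGalois F N := ⟨⟩
  have htop := hF.adjoin_eq_top (N := N) (i := ⟨i, hiN⟩) (Subtype.ext hi)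
  obtain ⟨x, y, hxy⟩ := hF.exists_eq_of_mem_adjoin (N := N) (i := ⟨i, hiN⟩) (Subtype.ext hi)
    (z := ⟨c, hcN⟩) (htop ▸ trivial)
  have hxy' : algebraMap K (AlgebraicClosure K) b =
      algebraMap K _ (algebraMap F K x) + algebraMap K _ (algebraMap F K y) * i := by
    rw [← IsScalarTower.algebraMap_apply, ← IsScalarTower.algebraMap_apply]
    exact congrArg Subtype.val hxy
  have hsq : (b - algebraMap F K x) ^ 2 + algebraMap F K y ^ 2 = 0 := by
    refine (algebraMap K (AlgebraicClosure K)).injective ?_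
    simp only [map_add, map_sub, map_pow, map_zero]
    rw [hxy']
    linear_combination algebraMap K _ (algebraMap F K y) ^ 2 * hi
  refine ⟨x, (sub_eq_zero.1 ?_).symm⟩
  exact isFormallyRealRing_iff.1 hK _ _ (.mul_self (algebraMap F K y)) (by linear_combination hsq)

end RealClosed

section RealClosedStar

theorem RingHom.isIntegralElem_iff_exists_coeff_mem_range {A B : Type*} [CommRing A] [CommRing B]
    {f : A →+* B} {b : B} : f.IsIntegralElem b ↔
      ∃ p : B[X], p.Monic ∧ (∀ n, p.coeff n ∈ f.range) ∧ eval b p = 0 := by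
  constructor
  · rintro ⟨p, hp, hb⟩
    exact ⟨p.map f, hp.map f, fun n => by simp, by rwa [eval_map]⟩
  · rintro ⟨p, hp, hc, hb⟩
    obtain ⟨q, rfl, -, hq⟩ := lifts_and_natDegree_eq_and_monic ((lifts_iff_coeff_lifts p).2 hc) hp
    exact ⟨q, hq, by rwa [eval_map] at hb⟩

variable {A : Type u} [CommRing A]

theorem IsRealClosedStar.surjective_algebraMap {B : Type u} [CommRing B] [Algebra A B]
    (hA : IsRealClosedStar A) (hinj : Function.Injective (algebraMap A B))
    (hB : IsFormallyRealRing B) (hintg : Algebra.IsIntegral A B)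
    (hess : ∀ b : B, b ≠ 0 → ∃ (c : B) (a : A), a ≠ 0 ∧ algebraMap A B a = c * b) :
    Function.Surjective (algebraMap A B) := by
  refine hA.2 B (algebraMap A B) hinj hB
    (fun b => RingHom.isIntegralElem_iff_exists_coeff_mem_range.1 (hintg.isIntegral b)) ?_
  intro I hI
  obtain ⟨b, hb, hb0⟩ := Submodule.exists_mem_ne_zero_of_ne_bot hI
  obtain ⟨c, a, ha, hac⟩ := hess b hb0
  exact ⟨algebraMap A B a, hac ▸ I.mul_mem_left c hb, ⟨a, rfl⟩,
    (map_ne_zero_iff _ hinj).2 ha⟩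

/-- A polynomial over a real closed * von Neumann regular ring `A` that has a root in a formally
real integral extension of `A` already has a root in `A`. -/
theorem IsRealClosedStar.exists_root_of_aeval_eq_zero (hreg : ∀ a : A, ∃ b : A, a = a * b * a)
    (hA : IsRealClosedStar A) {B : Type u} [CommRing B] [Algebra A B]
    (hinj : Function.Injective (algebraMap A B)) (hB : IsFormallyRealRing B)
    (hintg : Algebra.IsIntegral A B) {P : A[X]} {b : B} (hb : aeval b P = 0) :
    ∃ a : A, eval a P = 0 := by
  have := hB.isReduced
  have hregB := regular_of_isIntegral (B := B) hreg hintg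
  obtain ⟨I, -, hI⟩ := zorn_le_nonempty₀ {I : Ideal B | ∀ a, algebraMap A B a ∈ I → a = 0}
    (fun c hc hchain y hy => ⟨sSup c, fun a ha => by
      obtain ⟨J, hJ, haJ⟩ := (Submodule.mem_sSup_of_directed ⟨y, hy⟩ hchain.directedOn).1 ha
      exact hc hJ a haJ, fun z hz => le_sSup hz⟩) ⊥
    (fun a ha => hinj (by rw [map_zero]; exact ha))
  have hinjI : Function.Injective (algebraMap A (B ⧸ I)) := by
    rw [injective_iff_map_eq_zero]
    intro a ha
    exact hI.prop a (Ideal.Quotient.eq_zero_iff_mem.1 ha)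
  have hsurj := hA.surjective_algebraMap hinjI (hB.quotient_of_regular hregB I) inferInstance (by
    intro z hz
    obtain ⟨z, rfl⟩ := Ideal.Quotient.mk_surjective z
    rw [Ne, Ideal.Quotient.eq_zero_iff_mem] at hz
    by_contra! hcon
    have hmem : I ⊔ Ideal.span {z} ∈ {I : Ideal B | ∀ a, algebraMap A B a ∈ I → a = 0} := by
      intro a ha
      obtain ⟨y, hy, w, hw, hyw⟩ := Submodule.mem_sup.1 ha
      obtain ⟨c, rfl⟩ := Ideal.mem_span_singleton'.1 hw
      by_contra ha0
      refine hcon (Ideal.Quotient.mk I c) a ha0 ?_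
      rw [← map_mul]
      refine (Ideal.Quotient.eq.2 ?_ : Ideal.Quotient.mk I (algebraMap A B a) = _)
      rwa [← hyw, add_sub_cancel_right]
    exact hz (hI.le_of_ge hmem le_sup_left
      (le_sup_right (a := I) (Ideal.mem_span_singleton_self z))))
  obtain ⟨a, ha⟩ := hsurj (Ideal.Quotient.mk I b)
  refine ⟨a, hinjI ?_⟩
  rw [map_zero, ← aeval_algebraMap_apply_eq_algebraMap_eval, ha]
  have := aeval_algHom_apply (Ideal.Quotient.mkₐ A I) b P
  rw [hb, map_zero] at this
  exact this

/-- A monic polynomial over a real closed * von Neumann regular ring `A` has a root in `A` as soon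
as it has roots in enough formally real fields over `A`. -/
theorem IsRealClosedStar.exists_root (hreg : ∀ a : A, ∃ b : A, a = a * b * a)
    (hA : IsRealClosedStar A) {P : A[X]} (hP : P.Monic)
    (h : ∀ x : A, x ≠ 0 → ∃ (K : Type u) (_ : Field K) (f : A →+* K),
      IsFormallyRealRing K ∧ f x ≠ 0 ∧ ∃ y, eval₂ f y P = 0) : ∃ a : A, eval a P = 0 := by
  choose K hfield f hreal hf y hy using fun x : {x : A // x ≠ 0} => h x x.2
  let φ : A →+* ∀ x, K x := RingHom.pi f
  let : Algebra A (∀ x, K x) := φ.toAlgebra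
  have hroot : aeval (R := A) y P = 0 := by
    ext x
    have := hom_eval₂ P φ (Pi.evalRingHom K x) y
    exact this.trans (hy x)
  have hinj : Function.Injective φ := by
    rw [injective_iff_map_eq_zero]
    intro x hx
    by_contra hx0
    exact hf ⟨x, hx0⟩ (congrFun hx ⟨x, hx0⟩)
  let B := Algebra.adjoin A {y}
  let b : B := ⟨y, Algebra.self_mem_adjoin_singleton A y⟩
  refine hA.exists_root_of_aeval_eq_zero hreg (B := B) (b := b)
    (fun _ _ hxy => hinj (congrArg Subtype.val hxy))
    ((IsFormallyRealRing.pi hreal).of_injective B.val.toRingHom Subtype.val_injective)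
    (Algebra.IsIntegral.adjoin fun z hz => ?_) ?_
  · rw [Set.mem_singleton_iff.1 hz]
    exact ⟨P, hP, hroot⟩
  · refine Subtype.ext ?_
    have := aeval_algHom_apply B.val b P
    exact this.symm.trans hroot

theorem Ideal.exists_isPrime_notMem [IsReduced A] {x : A} (hx : x ≠ 0) :
    ∃ q : Ideal A, q.IsPrime ∧ x ∉ q := by
  by_contra! h
  refine hx (IsReduced.eq_zero x ?_)
  rw [← mem_nilradical, nilradical_eq_sInf]
  exact Ideal.mem_sInf.2 fun {q} hq => h q hq

theorem IsRealClosedStar.isBaer (hA : IsRealClosedStar A) : IsBaer A := by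
  intro S
  have := hA.1.isReduced
  let I : Ideal A := Submodule.annihilator (Ideal.span S)
  let J : Ideal A := Submodule.annihilator I
  have hI : ∀ r, r ∈ I ↔ ∀ s ∈ S, r * s = 0 := fun r => Submodule.mem_annihilator_span S r |>.trans
    ⟨fun h s hs => h ⟨s, hs⟩, fun h s => h s s.2⟩
  have hJ : ∀ r, r ∈ J ↔ ∀ s ∈ I, r * s = 0 := fun r => Submodule.mem_annihilator
  have hSJ : ∀ s ∈ S, s ∈ J := fun s hs => (hJ s).2 fun r hr => by
    rw [mul_comm]; exact (hI r).1 hr s hs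
  have hIJ : ∀ x, x ∈ I → x ∈ J → x = 0 := fun x hxI hxJ =>
    IsReduced.eq_zero x ⟨2, by rw [sq]; exact (hJ x).1 hxJ x hxI⟩
  have hinj : Function.Injective (algebraMap A ((A ⧸ I) × (A ⧸ J))) := by
    rw [injective_iff_map_eq_zero]
    intro x hx
    exact hIJ x (Ideal.Quotient.eq_zero_iff_mem.1 (congrArg Prod.fst hx))
      (Ideal.Quotient.eq_zero_iff_mem.1 (congrArg Prod.snd hx))
  have hsurj := hA.surjective_algebraMap hinj
    ((hA.1.quotient_annihilator S hI).prod (hA.1.quotient_annihilator (I : Set A) hJ))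
    inferInstance (by
      rintro ⟨x, y⟩ hxy
      obtain ⟨x, rfl⟩ := Ideal.Quotient.mk_surjective x
      obtain ⟨y, rfl⟩ := Ideal.Quotient.mk_surjective y
      by_cases hx : x ∈ I
      · by_cases hy : y ∈ J
        · refine absurd (Prod.ext ?_ ?_) hxy
          · exact Ideal.Quotient.eq_zero_iff_mem.2 hx
          · exact Ideal.Quotient.eq_zero_iff_mem.2 hy
        · rw [hJ] at hy
          push Not at hy
          obtain ⟨t, ht, hyt⟩ := hy
          refine ⟨(0, Ideal.Quotient.mk J t), y * t, hyt, Prod.ext ?_ ?_⟩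
          · exact (Ideal.Quotient.eq_zero_iff_mem.2 (I.mul_mem_left y ht)).trans (zero_mul _).symm
          · exact (map_mul (Ideal.Quotient.mk J) y t).trans (mul_comm _ _)
      · rw [hI] at hx
        push Not at hx
        obtain ⟨s, hs, hxs⟩ := hx
        refine ⟨(Ideal.Quotient.mk I s, 0), x * s, hxs, Prod.ext ?_ ?_⟩
        · exact (map_mul (Ideal.Quotient.mk I) x s).trans (mul_comm _ _)
        · exact (Ideal.Quotient.eq_zero_iff_mem.2 (J.mul_mem_left x (hSJ s hs))).trans
            (zero_mul _).symm)
  obtain ⟨e, he⟩ := hsurj (0, 1)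
  have heI : e ∈ I := Ideal.Quotient.eq_zero_iff_mem.1 (congrArg Prod.fst he)
  have heJ : e - 1 ∈ J := Ideal.Quotient.eq.1 (congrArg Prod.snd he)
  have hmul : ∀ r ∈ I, r = e * r := fun r hr => by linear_combination -(hJ _).1 heJ r hr
  refine ⟨e, (hmul e heI).symm, fun r => (hI r).symm.trans ⟨fun hr => ⟨r, hmul r hr⟩, ?_⟩⟩
  rintro ⟨x, rfl⟩
  exact I.mul_mem_right x heI

/-- Every element of a real closed * von Neumann regular ring is, up to a sign on each component of
a decomposition by an idempotent, a square. -/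
theorem IsRealClosedStar.exists_idempotent_sq_eq (hreg : ∀ a : A, ∃ b : A, a = a * b * a)
    (hA : IsRealClosedStar A) (a : A) :
    ∃ e y : A, e * e = e ∧ y ^ 2 = (2 * e - 1) * a := by
  have := hA.1.isReduced
  obtain ⟨e, he, hT⟩ := hA.isBaer {t : A | IsSumSq (t * t * -a)}
  have hTe : ∀ t, IsSumSq (t * t * -a) → e * t = 0 := (hT e).2 ⟨1, (mul_one e).symm⟩
  obtain ⟨y, hy⟩ := hA.exists_root hreg (monic_X_pow_sub_C ((2 * e - 1) * a) two_ne_zero) (by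
    intro x hx
    suffices h : ∃ q : Ideal A, q.IsPrime ∧ x ∉ q ∧ ∃ (K : Type u) (_ : Field K)
        (f : A ⧸ q →+* K), IsFormallyRealRing K ∧
          ∃ y, y ^ 2 = f (Ideal.Quotient.mk q ((2 * e - 1) * a)) by
      obtain ⟨q, hq, hxq, K, _, f, hK, y, hy⟩ := h
      refine ⟨K, _, f.comp (Ideal.Quotient.mk q), hK, ?_, y, by simpa [sub_eq_zero] using hy⟩
      have := hq.isMaximal_of_regular hreg
      let := Ideal.Quotient.field q
      rw [RingHom.comp_apply, Ne, map_eq_zero f]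
      exact fun h => hxq (Ideal.Quotient.eq_zero_iff_mem.1 h)
    by_cases hex : e * x = 0
    · obtain ⟨t, ht, hxt⟩ : ∃ t, IsSumSq (t * t * -a) ∧ x * t ≠ 0 := by
        by_contra! hcon
        obtain ⟨z, hz⟩ := (hT x).1 hcon
        exact hx (by rw [← hex, hz, ← mul_assoc, he])
      obtain ⟨q, hq, hxq⟩ := Ideal.exists_isPrime_notMem hxt
      have htq : t ∉ q := fun h => hxq (q.mul_mem_left x h)
      have heq : e ∈ q := (hq.mem_or_mem (show e * t ∈ q by
        rw [hTe t ht]; exact q.zero_mem)).resolve_right htq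
      have hmax := hq.isMaximal_of_regular hreg
      let := Ideal.Quotient.field q
      have hF : IsFormallyRealRing (A ⧸ q) := hA.1.quotient_of_regular hreg q
      refine ⟨q, hq, fun h => hxq (q.mul_mem_right t h), ?_⟩
      have hval : Ideal.Quotient.mk q ((2 * e - 1) * a) = -Ideal.Quotient.mk q a := by
        rw [map_mul, map_sub, map_mul, Ideal.Quotient.eq_zero_iff_mem.2 heq, map_one]
        ring
      rw [hval]
      obtain h | ⟨t', ht', hs'⟩ := hF.exists_sqrt_or_isSumSq (-Ideal.Quotient.mk q a)
      · exact h
      have hs := ht.map (Ideal.Quotient.mk q)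
      simp only [map_mul, map_neg] at hs
      have ht0 : Ideal.Quotient.mk q t ≠ 0 := fun h => htq (Ideal.Quotient.eq_zero_iff_mem.1 h)
      generalize Ideal.Quotient.mk q t = t at hs ht0
      generalize Ideal.Quotient.mk q a = a at hs hs'
      refine ⟨_, _, RingHom.id _, hF, 0, ?_⟩
      by_contra ha
      have ha0 : a ≠ 0 := fun h => ha (by simp [h])
      refine isFormallyRealRing_iff_not_isSumSq_neg_one.1 hF ?_
      have : (-1 : A ⧸ q) = ((t * t' * a)⁻¹ * (t * t' * a)⁻¹) *
          (t * t * -a * (t' * t' * - -a)) := by field_simp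
      rw [this]
      exact (IsSumSq.mul_self _).mul (hs.mul hs')
    · obtain ⟨q, hq, hxq⟩ := Ideal.exists_isPrime_notMem hex
      have heq : e ∉ q := fun h => hxq (q.mul_mem_right x h)
      have hmax := hq.isMaximal_of_regular hreg
      let := Ideal.Quotient.field q
      have hF : IsFormallyRealRing (A ⧸ q) := hA.1.quotient_of_regular hreg q
      refine ⟨q, hq, fun h => hxq (q.mul_mem_left e h), ?_⟩
      have he1 : Ideal.Quotient.mk q e = 1 := by
        refine Ideal.Quotient.eq.2 ((hq.mem_or_mem (?_ : e * (e - 1) ∈ q)).resolve_left heq)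
        rw [show e * (e - 1) = 0 by linear_combination he]
        exact q.zero_mem
      have hval : Ideal.Quotient.mk q ((2 * e - 1) * a) = Ideal.Quotient.mk q a := by
        rw [map_mul, map_sub, map_mul, he1, map_ofNat, map_one]
        ring
      rw [hval]
      obtain h | ⟨t, ht, hs⟩ := hF.exists_sqrt_or_isSumSq (Ideal.Quotient.mk q a)
      · exact h
      exfalso
      obtain ⟨t, rfl⟩ := Ideal.Quotient.mk_surjective t
      obtain ⟨s, hs', hst⟩ := hs.exists_of_surjective Ideal.Quotient.mk_surjective
      rw [← map_neg, ← map_mul, ← map_mul] at hst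
      obtain ⟨g, -, hgq, hg⟩ :=
        Ideal.exists_notMem_mul_eq_zero_of_regular hreg hq (Ideal.Quotient.eq.1 hst)
      have hgt : IsSumSq (g * t * (g * t) * -a) := by
        rw [show g * t * (g * t) * -a = g * g * s by linear_combination -g * hg]
        exact (IsSumSq.mul_self g).mul hs'
      have h0 : e * (g * t) ∈ q := by rw [hTe _ hgt]; exact q.zero_mem
      have htq : t ∉ q := fun h => ht (Ideal.Quotient.eq_zero_iff_mem.2 h)
      rcases hq.mem_or_mem h0 with h | h
      · exact heq h
      · exact (hq.mem_or_mem h).elim hgq htq)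
  exact ⟨e, y, he, by simpa [sub_eq_zero] using hy⟩

theorem IsRealClosedStar.exists_root_of_odd_natDegree (hreg : ∀ a : A, ∃ b : A, a = a * b * a)
    (hA : IsRealClosedStar A) {P : A[X]} (hP : P.Monic) (hodd : Odd P.natDegree) :
    ∃ a : A, eval a P = 0 := by
  have := hA.1.isReduced
  refine hA.exists_root hreg hP fun x hx => ?_
  obtain ⟨q, hq, hxq⟩ := Ideal.exists_isPrime_notMem hx
  have hmax := hq.isMaximal_of_regular hreg
  let := Ideal.Quotient.field q
  have hF : IsFormallyRealRing (A ⧸ q) := hA.1.quotient_of_regular hreg q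
  obtain ⟨K, _, f, hK, y, hy⟩ := hF.exists_root_of_odd_natDegree (P.map (Ideal.Quotient.mk q))
    (by rwa [hP.natDegree_map])
  refine ⟨K, _, f.comp (Ideal.Quotient.mk q), hK, ?_, y, by rwa [eval₂_map] at hy⟩
  rw [RingHom.comp_apply, Ne, map_eq_zero f]
  exact fun h => hxq (Ideal.Quotient.eq_zero_iff_mem.1 h)

theorem IsRealClosedStar.isRealClosedField_quotient (hreg : ∀ a : A, ∃ b : A, a = a * b * a)
    (hA : IsRealClosedStar A) {p : Ideal A} (hp : p.IsPrime) : IsRealClosedField (A ⧸ p) := by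
  have hmax := hp.isMaximal_of_regular hreg
  let := Ideal.Quotient.field p
  have hF : IsFormallyRealRing (A ⧸ p) := hA.1.quotient_of_regular hreg p
  refine ⟨Field.toIsField (A ⧸ p), ?_, fun x => ?_, fun g hg => ?_⟩
  · rw [← isSumSq_iff_exists_fin]
    exact isFormallyRealRing_iff_not_isSumSq_neg_one.1 hF
  · obtain ⟨a, rfl⟩ := Ideal.Quotient.mk_surjective x
    obtain ⟨e, y, he, hy⟩ := hA.exists_idempotent_sq_eq hreg a
    have hy' := congrArg (Ideal.Quotient.mk p) hy
    simp only [map_pow, map_mul, map_sub, map_ofNat, map_one] at hy'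
    rcases hp.mem_or_mem (show e * (e - 1) ∈ p by
      rw [show e * (e - 1) = 0 by linear_combination he]; exact p.zero_mem) with h | h
    · rw [Ideal.Quotient.eq_zero_iff_mem.2 h] at hy'
      exact .inr ⟨Ideal.Quotient.mk p y, by linear_combination hy'⟩
    · rw [Ideal.Quotient.eq.2 h, map_one] at hy'
      exact .inl ⟨Ideal.Quotient.mk p y, by linear_combination hy'⟩
  · have hg0 : g ≠ 0 := by rintro rfl; simp at hg
    have hmon := monic_mul_leadingCoeff_inv hg0
    obtain ⟨P, hPg, hPdeg, hP⟩ := lifts_and_natDegree_eq_and_monic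
      (f := Ideal.Quotient.mk p) (mem_lifts_of_surjective Ideal.Quotient.mk_surjective _) hmon
    rw [natDegree_mul_leadingCoeff_inv g hg0] at hPdeg
    obtain ⟨a, ha⟩ := hA.exists_root_of_odd_natDegree hreg hP (hPdeg ▸ hg)
    refine ⟨Ideal.Quotient.mk p a, ?_⟩
    have h := congrArg (eval (Ideal.Quotient.mk p a)) hPg
    rw [eval_map, eval₂_at_apply, ha, map_zero, eval_mul, eval_C] at h
    exact (mul_eq_zero.1 h.symm).resolve_right (inv_ne_zero (leadingCoeff_ne_zero.2 hg0))

/-- The idempotents of an essential extension of a Baer ring lie in the Baer ring. -/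
theorem IsBaer.mem_range_of_isIdempotentElem {B : Type*} [CommRing B] (hA : IsBaer A)
    {f : A →+* B} (hf : Function.Injective f) (hess : f.range.IsEssentialIn) {e : B}
    (he : e * e = e) : e ∈ f.range := by
  have hess' : ∀ b : B, (∀ a c, f a = b * c → a = 0) → b = 0 := by
    intro b hb
    by_contra hb0
    obtain ⟨x, hx, ⟨a, rfl⟩, ha⟩ := hess (Ideal.span {b}) (by simpa using hb0)
    obtain ⟨c, hc⟩ := Ideal.mem_span_singleton.1 hx
    exact ha (by rw [hb a c hc, map_zero])
  obtain ⟨g, hg, hann⟩ := hA {a | f a * e = 0}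
  have hg' : ∀ a, f a * e = 0 → g * a = 0 := (hann g).2 ⟨1, (mul_one g).symm⟩
  have h1 : f g * (1 - e) = 0 := by
    refine hess' _ fun a c hac => ?_
    have hae : f a * e = 0 := by rw [hac]; linear_combination -(f g * c) * he
    rw [← hg' a hae]
    refine hf ?_
    rw [map_mul, hac]
    have : f g * f g = f g := by rw [← map_mul, hg]
    linear_combination -(1 - e) * c * this
  have h2 : (1 - f g) * e = 0 := by
    refine hess' _ fun a c hac => ?_
    obtain ⟨x, rfl⟩ := (hann a).1 fun s (hs : f s * e = 0) => hf (by
      rw [map_mul, map_zero, hac]; linear_combination (1 - f g) * c * hs)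
    refine hf ?_
    have hgg : f g * f g = f g := by rw [← map_mul, hg]
    rw [map_mul] at hac
    rw [map_mul, map_zero]
    linear_combination f g * hac + (-(e * c) - f x) * hgg
  exact ⟨g, by linear_combination h1 - h2⟩

theorem IsBaer.isRealClosedStar (hreg : ∀ a : A, ∃ b : A, a = a * b * a)
    (hreal : IsFormallyRealRing A) (hA : IsBaer A)
    (hres : ∀ p : Ideal A, p.IsPrime → IsRealClosedField (A ⧸ p)) : IsRealClosedStar A := by
  refine ⟨hreal, fun B _ f hf hB hintg hess b => ?_⟩
  let := f.toAlgebra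
  have hintg' : Algebra.IsIntegral A B :=
    ⟨fun b => RingHom.isIntegralElem_iff_exists_coeff_mem_range.2 (hintg b)⟩
  have := hB.isReduced
  have hregB := regular_of_isIntegral (B := B) hreg hintg'
  let J : Ideal A :=
    { carrier := {a | f a * b ∈ f.range}
      add_mem' := fun {x y} hx hy => by
        simp only [Set.mem_ofPred_eq, map_add, add_mul] at *
        exact add_mem hx hy
      zero_mem' := ⟨0, by simp⟩
      smul_mem' := fun c x hx => by
        simp only [Set.mem_ofPred_eq, smul_eq_mul, map_mul, mul_assoc] at *
        exact mul_mem ⟨c, rfl⟩ hx }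
  suffices h : J = ⊤ by
    have h1 : f 1 * b ∈ f.range := (Ideal.eq_top_iff_one J).1 h
    rwa [map_one, one_mul] at h1
  by_contra hJ
  obtain ⟨m, hm, hJm⟩ := Ideal.exists_le_maximal J hJ
  obtain ⟨q, hqmax, hqm⟩ := Ideal.exists_ideal_over_maximal_of_isIntegral m (S := B)
    (((RingHom.injective_iff_ker_eq_bot f).1 hf).trans_le bot_le)
  have hlies : q.LiesOver m := ⟨hqm.symm⟩
  let := Ideal.Quotient.field m
  let := Ideal.Quotient.field q
  have hK : IsFormallyRealRing (B ⧸ q) := hB.quotient_of_regular hregB q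
  obtain ⟨a, ha⟩ := (hres m hm.isPrime).surjective_algebraMap hK (Ideal.Quotient.mk q b)
  obtain ⟨a, rfl⟩ := Ideal.Quotient.mk_surjective a
  obtain ⟨g, hg, hgq, hga⟩ := Ideal.exists_notMem_mul_eq_zero_of_regular hregB hqmax.isPrime
    (Ideal.Quotient.eq.1 (show Ideal.Quotient.mk q (f a) = Ideal.Quotient.mk q b from ha))
  obtain ⟨g, rfl⟩ := hA.mem_range_of_isIdempotentElem hf hess hg
  refine hgq ?_
  have : g ∈ m := hJm (show f g * b ∈ f.range from
    ⟨g * a, by rw [map_mul]; linear_combination hga⟩)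
  rw [← hqm] at this
  exact this

end RealClosedStar

/-- Let `A` be a formally real commutative von Neumann regular ring.
Then `A` is real closed * if and only if `A` is Baer and for every prime ideal `p` of
`A` the residue ring `A ⧸ p` is a real closed field. -/
theorem stmt_11 {A : Type u} [CommRing A] (hvnr : ∀ a : A, ∃ b : A, a = a * b * a)
    (hreal : IsFormallyRealRing A) :
    IsRealClosedStar A ↔
      (IsBaer A ∧ ∀ p : Ideal A, p.IsPrime → IsRealClosedField (A ⧸ p)) := by
  exact ⟨fun h => ⟨h.isBaer, fun _ hp => h.isRealClosedField_quotient hvnr hp⟩,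
    fun h => h.1.isRealClosedStar hvnr hreal h.2⟩
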